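/- For a semigroup X the following conditions are equivalent: (1) N₂(X) is a commutative Clifford semigroup; (2) N₂(X) is an inverse semigroup; (3) the idempotents of the semigroup N₂(X) commute and N₂(X) is sub-Clifford or regular; (4) X is isomorphic to C₂ or to Lₙ for some integer n ≥ 0. -/

import Mathlib

open Set

/-- An *upfamily* on `X`: a nonempty family of nonempty subsets of `X`
that is closed under taking supersets. -/
def IsUpfamily {X : Type*} (F : Set (Set X)) : Prop :=
  F.Nonempty ∧ (∀ A ∈ F, A.Nonempty) ∧ ∀ A ∈ F, ∀ B : Set X, A ⊆ B → B ∈ F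

/-- The space `υ(X)` of upfamilies on `X`. -/
def Upfamily (X : Type*) : Type _ := {F : Set (Set X) // IsUpfamily F}

/-- The extension of the binary operation of `X` to families of subsets of `X`:
`𝓐*𝓑 = ⟨⋃_{a ∈ A} a*B_a : A ∈ 𝓐, {B_a}_{a∈A} ⊆ 𝓑⟩`. -/
def upMul {X : Type*} [Mul X] (F G : Set (Set X)) : Set (Set X) :=
  {C | ∃ A ∈ F, ∃ B : X → Set X, (∀ a ∈ A, B a ∈ G) ∧ (⋃ a ∈ A, (fun y => a * y) '' B a) ⊆ C}

theorem IsUpfamily.upMul {X : Type*} [Mul X] {F G : Set (Set X)}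
    (hF : IsUpfamily F) (hG : IsUpfamily G) : IsUpfamily (upMul F G) := by
  obtain ⟨⟨A0, hA0⟩, hFne, hFup⟩ := hF
  obtain ⟨⟨B0, hB0⟩, hGne, hGup⟩ := hG
  refine ⟨⟨univ, A0, hA0, fun _ => B0, fun a _ => hB0, subset_univ _⟩, ?_, ?_⟩
  · rintro C ⟨A, hA, B, hB, hsub⟩
    obtain ⟨a, ha⟩ := hFne A hA
    obtain ⟨b, hb⟩ := hGne (B a) (hB a ha)
    exact ⟨a * b, hsub (mem_biUnion ha ⟨b, hb, rfl⟩)⟩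
  · rintro C ⟨A, hA, B, hB, hsub⟩ D hCD
    exact ⟨A, hA, B, hB, hsub.trans hCD⟩

/-- `υ(X)` is a semigroup under the extended operation. -/
instance {X : Type*} [Mul X] : Mul (Upfamily X) :=
  ⟨fun F G => ⟨upMul F.1 G.1, F.2.upMul G.2⟩⟩

/-- The embedding `X → υ(X)`, `x ↦ ⟨x⟩ = {A ⊆ X : x ∈ A}`. -/
def Upfamily.principal {X : Type*} (x : X) : Upfamily X :=
  ⟨{A | x ∈ A}, ⟨univ, mem_univ x⟩, fun A hA => ⟨x, hA⟩, fun _ hA _ hAB => hAB hA⟩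

/-- An upfamily is linked if any two of its members intersect. -/
def Upfamily.Linked {X : Type*} (F : Upfamily X) : Prop :=
  ∀ A ∈ F.1, ∀ B ∈ F.1, (A ∩ B).Nonempty

/-- Maximal linked upfamilies. -/
def Upfamily.IsMaxLinked {X : Type*} (F : Upfamily X) : Prop :=
  F.Linked ∧ ∀ G : Upfamily X, G.Linked → F.1 ⊆ G.1 → F = G

/-- Filters: upfamilies closed under binary intersections. -/
def Upfamily.IsFilter {X : Type*} (F : Upfamily X) : Prop :=
  ∀ A ∈ F.1, ∀ B ∈ F.1, A ∩ B ∈ F.1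

/-- Ultrafilters: maximal filters. -/
def Upfamily.IsUltrafilter {X : Type*} (F : Upfamily X) : Prop :=
  F.IsFilter ∧ ∀ G : Upfamily X, G.IsFilter → F.1 ⊆ G.1 → F = G

/-- The superextension `λ(X)` of maximal linked upfamilies. -/
def lambdaS (X : Type*) : Set (Upfamily X) := {F | F.IsMaxLinked}

/-- The semigroup `N₂(X)` of linked upfamilies. -/
def N2S (X : Type*) : Set (Upfamily X) := {F | F.Linked}

/-- The semigroup `φ(X)` of filters. -/
def phiS (X : Type*) : Set (Upfamily X) := {F | F.IsFilter}

/-- The Stone-Čech extension `β(X)` of ultrafilters. -/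
def betaS (X : Type*) : Set (Upfamily X) := {F | F.IsUltrafilter}

section SemigroupProps

variable {M : Type*} [Mul M]

/-- A subset closed under multiplication (i.e. a subsemigroup). -/
def mulClosed (S : Set M) : Prop := ∀ a ∈ S, ∀ b ∈ S, a * b ∈ S

/-- The operation is commutative on `S`. -/
def commOn (S : Set M) : Prop := ∀ a ∈ S, ∀ b ∈ S, a * b = b * a

/-- The idempotents of `S` commute. -/
def idemCommOn (S : Set M) : Prop :=
  ∀ a ∈ S, ∀ b ∈ S, a * a = a → b * b = b → a * b = b * a

/-- `S` is an inverse semigroup: every element has a unique inverse in `S`. -/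
def inverseOn (S : Set M) : Prop :=
  ∀ a ∈ S, ∃! b, b ∈ S ∧ a * b * a = a ∧ b * a * b = b

/-- `H` is a subgroup of the ambient multiplicative structure:
it is closed under multiplication and carries a group structure. -/
def IsSubgroupIn (H : Set M) : Prop :=
  (∀ a ∈ H, ∀ b ∈ H, a * b ∈ H) ∧
    ∃ e ∈ H, (∀ a ∈ H, e * a = a ∧ a * e = a) ∧ ∀ a ∈ H, ∃ b ∈ H, a * b = e ∧ b * a = e

/-- `S` is a Clifford semigroup: a union of groups. -/
def cliffordOn (S : Set M) : Prop := ∀ a ∈ S, ∃ H ⊆ S, IsSubgroupIn H ∧ a ∈ H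

/-- `S` is regular in `T`: every `a ∈ S` satisfies `a ∈ a T a`. -/
def regularIn (S T : Set M) : Prop := ∀ a ∈ S, ∃ b ∈ T, a * b * a = a

/-- `ppow a n = a^(n+1)`: positive powers in a semigroup. -/
def ppow (a : M) : ℕ → M
  | 0 => a
  | n + 1 => ppow a n * a

/-- `S` is sub-Clifford: `x^{n+1} = x^{m+1}` implies `x^n = x^m` for positive `n < m`. -/
def subCliffordOn (S : Set M) : Prop :=
  ∀ a ∈ S, ∀ n m : ℕ, n < m → ppow a (n + 1) = ppow a (m + 1) → ppow a n = ppow a m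

end SemigroupProps

/-- The cyclic group `Cₙ` of order `n`. -/
abbrev Cgrp (n : ℕ) : Type := Multiplicative (ZMod n)

/-- The linear semilattice `Lₙ = {0,…,n-1}` with the operation of minimum. -/
def L (n : ℕ) : Type := Fin n

instance {n : ℕ} : Mul (L n) :=
  ⟨fun a b => show Fin n from min (show Fin n from a) (show Fin n from b)⟩

/-- The disjoint ordered union `X ⊔ Y` of two semigroups, in which
`x * y = y * x = x` for `x ∈ X` and `y ∈ Y`. -/
abbrev OSum (A B : Type*) : Type _ := A ⊕ B

instance {A B : Type*} [Mul A] [Mul B] : Mul (OSum A B) :=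
  ⟨fun x y =>
    match x, y with
    | Sum.inl a, Sum.inl a' => Sum.inl (a * a')
    | Sum.inl a, Sum.inr _ => Sum.inl a
    | Sum.inr _, Sum.inl a => Sum.inl a
    | Sum.inr b, Sum.inr b' => Sum.inr (b * b')⟩

/-- `M` is isomorphic to the sub-semigroup `S` of `N`: there is an injective
operation-preserving map of `M` onto `S`. -/
def MulIsoOnto (M : Type*) [Mul M] {N : Type*} [Mul N] (S : Set N) : Prop :=
  ∃ f : M → N, Function.Injective f ∧ Set.range f = S ∧ ∀ x y : M, f (x * y) = f x * f y

namespace Upfamily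

variable {X : Type*}

@[ext]
theorem ext_mem {F G : Upfamily X} (h : ∀ C, C ∈ F.1 ↔ C ∈ G.1) : F = G :=
  Subtype.ext (Set.ext h)

theorem mono (F : Upfamily X) {A B : Set X} (hA : A ∈ F.1) (h : A ⊆ B) : B ∈ F.1 :=
  F.2.2.2 A hA B h

/-- The principal filter `⟨K⟩` generated by a nonempty set. -/
def gen (K : Set X) (hK : K.Nonempty) : Upfamily X :=
  ⟨{A | K ⊆ A}, ⟨K, Subset.rfl⟩, fun _ hA => hK.mono hA, fun _ hA _ h => Subset.trans hA h⟩

theorem mem_gen {K A : Set X} {hK : K.Nonempty} : A ∈ (gen K hK).1 ↔ K ⊆ A := Iff.rfl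

theorem linked_gen (K : Set X) (hK : K.Nonempty) : (gen K hK).Linked :=
  fun _ hA _ hB => hK.mono (subset_inter hA hB)

theorem gen_congr {K M : Set X} {hK : K.Nonempty} (h : K = M) :
    gen K hK = gen M (h ▸ hK) := by
  subst h; rfl

theorem gen_inj {K M : Set X} {hK : K.Nonempty} {hM : M.Nonempty} (h : gen K hK = gen M hM) :
    K = M := by
  have h1 : M ∈ (gen K hK).1 := h ▸ Subset.rfl
  have h2 : K ∈ (gen M hM).1 := h ▸ Subset.rfl
  exact Subset.antisymm h1 h2

/-- The filter of sets containing almost all terms of a sequence. -/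
def tail (s : ℕ → X) : Upfamily X :=
  ⟨{C | ∀ᶠ n in Filter.atTop, s n ∈ C}, ⟨univ, by simp⟩,
    fun _ hA => (hA.exists).imp' s fun _ h => h, fun _ hA _ h => hA.mono fun _ hn => h hn⟩

theorem mem_tail {s : ℕ → X} {C : Set X} :
    C ∈ (tail s).1 ↔ ∀ᶠ n in Filter.atTop, s n ∈ C := Iff.rfl

theorem linked_tail (s : ℕ → X) : (tail s).Linked := by
  intro A hA B hB
  obtain ⟨n, hn⟩ := (hA.and hB).exists
  exact ⟨s n, hn⟩

/-- `C` contains at least two of the terms `p`, `q`, `r`. -/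
def TwoOf (C : Set X) (p q r : X) : Prop :=
  (p ∈ C ∧ q ∈ C) ∨ (p ∈ C ∧ r ∈ C) ∨ (q ∈ C ∧ r ∈ C)

theorem TwoOf.inter {A B : Set X} {p q r : X} (hA : TwoOf A p q r) (hB : TwoOf B p q r) :
    (A ∩ B).Nonempty := by
  unfold TwoOf at hA hB
  have : p ∈ A ∩ B ∨ q ∈ A ∩ B ∨ r ∈ A ∩ B := by simp only [mem_inter_iff]; tauto
  rcases this with h | h | h <;> exact ⟨_, h⟩

theorem TwoOf.mono {A B : Set X} {p q r : X} (hA : TwoOf A p q r) (h : A ⊆ B) :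
    TwoOf B p q r :=
  hA.imp (fun t => ⟨h t.1, h t.2⟩) (Or.imp (fun t => ⟨h t.1, h t.2⟩) fun t => ⟨h t.1, h t.2⟩)

/-- The sets that contain at least two of almost all triples of consecutive terms. -/
def majTail (s : ℕ → X) : Upfamily X :=
  ⟨{C | ∀ᶠ n in Filter.atTop, TwoOf C (s n) (s (n + 1)) (s (n + 2))},
    ⟨univ, by simp [TwoOf]⟩,
    fun A hA => by
      obtain ⟨n, hn⟩ := hA.exists
      simpa using hn.inter hn,
    fun _ hA _ h => hA.mono fun _ hn => hn.mono h⟩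

theorem mem_majTail {s : ℕ → X} {C : Set X} : C ∈ (majTail s).1 ↔
    ∀ᶠ n in Filter.atTop, TwoOf C (s n) (s (n + 1)) (s (n + 2)) := Iff.rfl

theorem linked_majTail (s : ℕ → X) : (majTail s).Linked := by
  intro A hA B hB
  obtain ⟨n, hn⟩ := (hA.and hB).exists
  exact hn.1.inter hn.2

/-- The sets that contain at least two of three given points. -/
def maj (p q r : X) : Upfamily X :=
  ⟨{C | TwoOf C p q r}, ⟨univ, by simp [TwoOf]⟩, fun A hA => by simpa using hA.inter hA,
    fun _ hA _ h => hA.mono h⟩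

theorem mem_maj {p q r : X} {C : Set X} : C ∈ (maj p q r).1 ↔ TwoOf C p q r := Iff.rfl

theorem linked_maj (p q r : X) : (maj p q r).Linked := fun _ hA _ hB => hA.inter hB

theorem linked_cases_of_two {e a : X} (hX : ∀ c : X, c = e ∨ c = a) {F : Upfamily X}
    (hF : F.Linked) :
    (∃ x, F = gen {x} (singleton_nonempty x)) ∨ F = gen univ (nonempty_of_mem (mem_univ e)) := by
  by_cases h : ∃ x, {x} ∈ F.1
  · obtain ⟨x, hx⟩ := h
    refine Or.inl ⟨x, ext_mem fun C => ⟨fun hC => ?_, fun hC => F.mono hx hC⟩⟩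
    obtain ⟨y, rfl, hy⟩ := hF _ hx _ hC
    exact singleton_subset_iff.2 hy
  · refine Or.inr (ext_mem fun C => ⟨fun hC => ?_, fun hC => ?_⟩)
    · by_contra hne
      obtain ⟨z, -, hz⟩ := not_subset.1 hne
      obtain ⟨w, hw⟩ := F.2.2.1 _ hC
      refine h ⟨w, F.mono hC fun v hv => ?_⟩
      have hvz : v ≠ z := fun h => hz (h ▸ hv)
      have hwz : w ≠ z := fun h => hz (h ▸ hw)
      rw [mem_singleton_iff]
      rcases hX v with h1 | h1 <;> rcases hX w with h2 | h2 <;> rcases hX z with h3 | h3 <;>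
        simp_all
    · obtain ⟨A, hA⟩ := F.2.1
      exact F.mono hA ((subset_univ _).trans hC)

section Magma

variable [Mul X]

theorem mem_mul {F G : Upfamily X} {C : Set X} :
    C ∈ (F * G).1 ↔ {x | {y | x * y ∈ C} ∈ G.1} ∈ F.1 := by
  constructor
  · rintro ⟨A, hA, B, hB, hsub⟩
    refine F.mono hA fun a ha => G.mono (hB a ha) fun b hb => ?_
    exact hsub (mem_biUnion ha ⟨b, hb, rfl⟩)
  · intro h
    refine ⟨_, h, fun x => {y | x * y ∈ C}, fun a ha => ha, ?_⟩
    simp only [iUnion_subset_iff]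
    rintro a - _ ⟨y, hy, rfl⟩
    exact hy

theorem Linked.mul {F G : Upfamily X} (hF : F.Linked) (hG : G.Linked) : (F * G).Linked := by
  intro A hA B hB
  obtain ⟨x, hxA, hxB⟩ := hF _ (mem_mul.1 hA) _ (mem_mul.1 hB)
  obtain ⟨y, hyA, hyB⟩ := hG _ hxA _ hxB
  exact ⟨x * y, hyA, hyB⟩

theorem gen_mul_gen {K M : Set X} (hK : K.Nonempty) (hM : M.Nonempty) :
    gen K hK * gen M hM = gen (image2 (· * ·) K M) (hK.image2 hM) := by
  ext C
  simp only [mem_mul, mem_gen, image2_subset_iff]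
  rfl

theorem gen_singleton_mul (x y : X) :
    gen {x} (singleton_nonempty x) * gen {y} (singleton_nonempty y) =
      gen {x * y} (singleton_nonempty _) := by
  rw [gen_mul_gen]
  exact gen_congr image2_singleton

/-- A linked family with a member `S` acts trivially from the left on `S`-invariant families. -/
theorem mul_eq_right {F G : Upfamily X} {S : Set X} (hF : F.Linked) (hS : S ∈ F.1)
    (hG : ∀ x ∈ S, ∀ C, {y | x * y ∈ C} ∈ G.1 ↔ C ∈ G.1) : F * G = G := by
  ext C
  rw [mem_mul]
  constructor
  · intro h
    obtain ⟨x, hx, hxS⟩ := hF _ h _ hS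
    exact (hG x hxS C).1 hx
  · intro h
    exact F.mono hS fun x hx => (hG x hx C).2 h

/-- Two linked families that are invariant under a common member coincide
when idempotents commute. -/
theorem eq_of_invariant (hc : idemCommOn (N2S X)) {F G : Upfamily X} {S : Set X}
    (hF : F.Linked) (hG : G.Linked) (hSF : S ∈ F.1) (hSG : S ∈ G.1)
    (hiF : ∀ x ∈ S, ∀ C, {y | x * y ∈ C} ∈ F.1 ↔ C ∈ F.1)
    (hiG : ∀ x ∈ S, ∀ C, {y | x * y ∈ C} ∈ G.1 ↔ C ∈ G.1) : F = G := by
  have h := hc F hF G hG (mul_eq_right hF hSF hiF) (mul_eq_right hG hSG hiG)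
  rwa [mul_eq_right hF hSF hiG, mul_eq_right hG hSG hiF, eq_comm] at h

/-- Every upfamily on a linear magma is idempotent. -/
theorem mul_self_of_linear (hl : ∀ x y : X, x * y = x ∨ x * y = y) (F : Upfamily X) :
    F * F = F := by
  ext C
  rw [mem_mul]
  constructor
  · intro h
    by_cases hD : {x | {y | x * y ∈ C} ∈ F.1} ⊆ C
    · exact F.mono h hD
    · obtain ⟨x, hx, hxC⟩ := not_subset.1 hD
      refine F.mono hx fun y (hy : x * y ∈ C) => ?_
      rcases hl x y with h | h
      · exact absurd (h ▸ hy) hxC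
      · exact h ▸ hy
  · intro h
    refine F.mono h fun x hx => F.mono h fun y hy => ?_
    rcases hl x y with h | h
    · rwa [mem_ofPred_eq, h]
    · rwa [mem_ofPred_eq, h]

end Magma

section Semigroup

variable [Semigroup X]

protected theorem mul_assoc (F G H : Upfamily X) : F * G * H = F * (G * H) := by
  ext C
  simp only [mem_mul, mem_ofPred_eq, mul_assoc]

theorem ppow_mul_ppow (a : X) (m n : ℕ) : ppow a m * ppow a n = ppow a (m + n + 1) := by
  induction n with
  | zero => rfl
  | succ n ih => rw [ppow, ← mul_assoc, ih]; rfl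

theorem ppow_gen_singleton (a : X) (n : ℕ) :
    ppow (gen {a} (singleton_nonempty a)) n = gen {ppow a n} (singleton_nonempty _) := by
  induction n with
  | zero => rfl
  | succ n ih => rw [ppow, ih, gen_singleton_mul]; rfl

/-- Regularity or the sub-Clifford property, applied to the filter generated by `K`. -/
theorem exists_mul_mul_mem (h : subCliffordOn (N2S X) ∨ regularIn (N2S X) (N2S X))
    {K M : Set X} (h1 : image2 (· * ·) K K = M) (h2 : image2 (· * ·) M K = M)
    {u w : X} (hu : u ∈ K) (hw : w ∈ K) :
    ∃ x, ∀ v ∈ K, u * x * v ∈ K ∧ w * x * v ∈ K := by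
  have hK : K.Nonempty := ⟨u, hu⟩
  rcases h with h | h
  · have := h (gen K hK) (linked_gen K hK) 0 1 one_pos (by
      simp only [ppow, gen_mul_gen]
      exact gen_congr (by rw [h1, h2]))
    simp only [ppow, gen_mul_gen] at this
    have hKK : ∀ p ∈ K, ∀ q ∈ K, p * q ∈ K := by
      rw [← image2_subset_iff]
      exact (gen_inj this).superset
    exact ⟨u, fun v hv => ⟨hKK _ (hKK _ hu _ hu) _ hv, hKK _ (hKK _ hw _ hu) _ hv⟩⟩
  · obtain ⟨G, hG, hKG⟩ := h (gen K hK) (linked_gen K hK)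
    rw [Upfamily.mul_assoc] at hKG
    have hmem : K ∈ (gen K hK).1 := mem_gen.2 Subset.rfl
    rw [← hKG, mem_mul, mem_gen] at hmem
    obtain ⟨x, hx, hx'⟩ := hG _ (mem_mul.1 (hmem hu)) _ (mem_mul.1 (hmem hw))
    refine ⟨x, fun v hv => ?_⟩
    rw [mul_assoc, mul_assoc]
    exact ⟨hx hv, hx' hv⟩

end Semigroup

end Upfamily

section Necessity

variable {X : Type*} [Semigroup X]

open Upfamily

/-- If the idempotents of `N₂(X)` commute, then the idempotents of `X` are central. -/
theorem commute_of_idem (hc : idemCommOn (N2S X)) {e : X} (he : e * e = e) (x : X) :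
    e * x = x * e := by
  have key : ∀ K : Set X, image2 (· * ·) K K = K → K.Nonempty →
      image2 (· * ·) {e} K = image2 (· * ·) K {e} := by
    intro K hKK hK
    have h := hc (gen {e} (singleton_nonempty e)) (linked_gen _ _) (gen K hK) (linked_gen _ _)
      (by simp only [gen_mul_gen]; exact gen_congr (by simp [he]))
      (by rw [gen_mul_gen]; exact gen_congr hKK)
    simp only [gen_mul_gen] at h
    exact gen_inj h
  have h1 : e * x = e * x * e := by
    have hK := key (range (e * ·))
      (by
        ext z
        simp only [mem_image2, mem_range]
        constructor
        · rintro ⟨_, ⟨a, rfl⟩, _, ⟨b, rfl⟩, rfl⟩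
          exact ⟨a * (e * b), by simp only [mul_assoc]⟩
        · rintro ⟨a, rfl⟩
          exact ⟨e * e, ⟨e, rfl⟩, e * a, ⟨a, rfl⟩, by simp only [he, ← mul_assoc]⟩)
      ⟨_, e, rfl⟩
    have hx : e * x ∈ image2 (· * ·) {e} (range (e * ·)) :=
      ⟨e, rfl, e * x, ⟨x, rfl⟩, by simp only [he, ← mul_assoc]⟩
    rw [hK] at hx
    obtain ⟨z, -, _, rfl, hz⟩ := hx
    simp only at hz
    rw [← hz, mul_assoc, he]
  have h2 : x * e = e * (x * e) := by
    have hK := key (range (· * e))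
      (by
        ext z
        simp only [mem_image2, mem_range]
        constructor
        · rintro ⟨_, ⟨a, rfl⟩, _, ⟨b, rfl⟩, rfl⟩
          exact ⟨a * e * b, by simp only [mul_assoc]⟩
        · rintro ⟨a, rfl⟩
          exact ⟨a * e, ⟨a, rfl⟩, e * e, ⟨e, rfl⟩, by simp only [he, mul_assoc]⟩)
      ⟨_, e, rfl⟩
    have hx : x * e ∈ image2 (· * ·) (range (· * e)) {e} :=
      ⟨x * e, ⟨x, rfl⟩, e, rfl, by simp only [he, mul_assoc]⟩
    rw [← hK] at hx
    obtain ⟨_, rfl, z, -, hz⟩ := hx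
    simp only at hz
    rw [← hz, ← mul_assoc, he]
  rw [h1, mul_assoc, ← h2]

theorem exists_ppow_add_two_eq (hc : idemCommOn (N2S X)) (a : X) :
    ∃ n, ppow a (n + 2) = ppow a n := by
  by_contra! hne
  have hne1 : ∀ n, ppow a (n + 1) ≠ ppow a n := fun n h =>
    hne n <| by
      have h' := congrArg (· * a) h
      exact (show ppow a (n + 2) = ppow a (n + 1) from h').trans h
  have hmul : ∀ m n, ppow a m * ppow a n = ppow a (n + (m + 1)) := fun m n => by
    rw [ppow_mul_ppow]; congr 1; ring
  have hshift : ∀ (k : ℕ) (p : ℕ → Prop),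
      (∀ᶠ n in Filter.atTop, p (n + k)) ↔ ∀ᶠ n in Filter.atTop, p n := fun k p => by
    conv_rhs => rw [← Filter.map_add_atTop_eq_nat k]
    rfl
  have heq : tail (ppow a) = majTail (ppow a) := by
    refine eq_of_invariant hc (S := range (ppow a)) (linked_tail _) (linked_majTail _)
      (by simp [mem_tail]) (by simp [mem_majTail, TwoOf]) ?_ ?_
    · rintro _ ⟨m, rfl⟩ C
      simp only [mem_tail, mem_ofPred_eq, hmul]
      exact hshift _ (fun n => ppow a n ∈ C)
    · rintro _ ⟨m, rfl⟩ C
      simp only [mem_majTail, TwoOf, mem_ofPred_eq, hmul, add_right_comm _ _ (m + 1)]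
      exact hshift _ (fun n => TwoOf C (ppow a n) (ppow a (n + 1)) (ppow a (n + 2)))
  by_cases hinj : Function.Injective (ppow a)
  · have hC : (ppow a '' {n | n % 3 = 0})ᶜ ∈ (majTail (ppow a)).1 := by
      refine mem_majTail.2 (Filter.Eventually.of_forall fun n => ?_)
      simp only [TwoOf, mem_compl_iff, hinj.mem_set_image, mem_ofPred_eq]
      omega
    rw [← heq, mem_tail] at hC
    obtain ⟨N, hN⟩ := Filter.eventually_atTop.1 hC
    exact hN (3 * N) (by omega) ⟨3 * N, by simp, rfl⟩
  · obtain ⟨m, k, hk, hmk⟩ : ∃ m k, 0 < k ∧ ppow a (m + k) = ppow a m := by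
      simp only [Function.Injective, not_forall] at hinj
      obtain ⟨m, n, h, hmn⟩ := hinj
      rcases lt_or_gt_of_ne hmn with h' | h'
      · exact ⟨m, n - m, by omega, by rw [h]; congr 1; omega⟩
      · exact ⟨n, m - n, by omega, by rw [← h]; congr 1; omega⟩
    have hrec : ∀ j, ppow a (m + j * k) = ppow a m := by
      intro j
      induction j with
      | zero => simp
      | succ j ih =>
        rcases Nat.exists_eq_add_of_lt hk with ⟨i, hi⟩
        have : m + (j + 1) * k = (m + j * k) + i + 1 := by rw [hi]; ring
        rw [this, ← ppow_mul_ppow, ih, ppow_mul_ppow, ← hmk]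
        congr 1; omega
    have hC : {ppow a m}ᶜ ∈ (majTail (ppow a)).1 := by
      refine mem_majTail.2 (Filter.Eventually.of_forall fun n => ?_)
      have h1 := hne n
      have h2 := hne1 n
      have h3 := hne1 (n + 1)
      simp only [TwoOf, mem_compl_iff, mem_singleton_iff]
      grind
    rw [← heq, mem_tail] at hC
    obtain ⟨N, hN⟩ := Filter.eventually_atTop.1 hC
    exact hN (m + N * k) (by nlinarith) (hrec N)

theorem mul_mul_self (hc : idemCommOn (N2S X))
    (h : subCliffordOn (N2S X) ∨ regularIn (N2S X) (N2S X)) (a : X) : a * a * a = a := by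
  have step : ∀ n, ppow a (n + 3) = ppow a (n + 1) → ppow a (n + 2) = ppow a n := by
    intro n hn
    rcases h with h | h
    · have := h (gen {a} (singleton_nonempty a)) (linked_gen _ _) n (n + 2) (by omega)
        (by simp only [ppow_gen_singleton, hn])
      rw [ppow_gen_singleton, ppow_gen_singleton] at this
      exact (singleton_injective (gen_inj this)).symm
    · obtain ⟨G, -, hG⟩ := h (gen {a} (singleton_nonempty a)) (linked_gen _ _)
      obtain ⟨y, hy⟩ : ∃ y, a * y * a = a := by
        have hmem : {a} ∈ (gen {a} (singleton_nonempty a)).1 := mem_gen.2 Subset.rfl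
        rw [← hG, Upfamily.mem_mul, Upfamily.mem_mul, mem_gen, singleton_subset_iff] at hmem
        obtain ⟨y, hy⟩ := G.2.2.1 _ hmem
        exact ⟨y, hy rfl⟩
      have e1 : (a * y) * (a * y) = a * y := by rw [← mul_assoc, hy]
      have e2 : (y * a) * (y * a) = y * a := by rw [mul_assoc, ← mul_assoc a, hy]
      have e3 : y * a = a * y := by
        calc y * a = y * (a * y * a) := by rw [hy]
          _ = (y * (a * y)) * a := by simp only [mul_assoc]
          _ = (a * y * y) * a := by rw [commute_of_idem hc e1 y]
          _ = (a * y) * (y * a) := by simp only [mul_assoc]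
          _ = (y * a * a) * y := by rw [commute_of_idem hc e1 (y * a)]; simp only [mul_assoc]
          _ = (a * (y * a)) * y := by rw [commute_of_idem hc e2 a]
          _ = a * y := by rw [← mul_assoc, hy]
      have cancel : ∀ k, y * ppow a (k + 1) = ppow a k := by
        intro k
        induction k with
        | zero => exact (mul_assoc y a a).symm.trans (by rw [e3, hy]; rfl)
        | succ k ih => rw [ppow, ← mul_assoc, ih]; rfl
      rw [← cancel n, ← cancel (n + 2), hn]
  obtain ⟨n, hn⟩ := exists_ppow_add_two_eq hc a
  induction n with
  | zero => exact hn
  | succ n ih => exact ih (step n hn)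

theorem mul_self_idem {a : X} (ha : a * a * a = a) : a * a * (a * a) = a * a := by
  rw [← mul_assoc, ha]

/-- A nontrivial group element lies above no idempotent other than those of its subgroup. -/
theorem eq_of_mul_eq (hc : idemCommOn (N2S X))
    (h : subCliffordOn (N2S X) ∨ regularIn (N2S X) (N2S X)) {a f : X} (ha : a * a ≠ a)
    (hf : f * f = f) (hfa : f * (a * a) = a * a) : f = a * a := by
  by_contra hne
  have ha3 := mul_mul_self hc h a
  have hfa' : f * a = a := by rw [← ha3, ← mul_assoc f, hfa]
  have haf : a * f = a := by rw [← commute_of_idem hc hf, hfa']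
  have haa : a * (a * a) = a := by rw [← mul_assoc, ha3]
  obtain ⟨x, hx⟩ := exists_mul_mul_mem h (K := {f, a}) (M := {f, a, a * a})
    (by ext z; simp [ hf, hfa', haf]; grind)
    (by ext z; simp [ hf, hfa', haf, ha3, mul_assoc]; grind)
    (u := a) (w := a) (by simp) (by simp)
  have h1 := (hx f (by simp)).1
  have h2 := (hx a (by simp)).1
  rw [mul_assoc, ← commute_of_idem hc hf, ← mul_assoc, haf] at h1
  rcases h1 with h1 | h1
  · have : a * a * f = f := by rw [← h1, ← mul_assoc, ha3]
    rw [← commute_of_idem hc hf, hfa] at this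
    exact hne this.symm
  · rw [show a * x = a from h1] at h2
    rcases h2 with h2 | h2
    · exact hne h2.symm
    · exact ha h2

/-- A nontrivial group element is not annihilated by a smaller idempotent. -/
theorem eq_of_zero (hc : idemCommOn (N2S X)) {a g : X} (ha : a * a ≠ a) (ha3 : a * a * a = a)
    (hg : g * g = g) (hga : g * a = g) : g = a * a := by
  by_contra hne
  have hag : a * g = g := by rw [← commute_of_idem hc hg, hga]
  have haa : a * (a * a) = a := by rw [← mul_assoc, ha3]
  have hne' : g ≠ a := by rintro rfl; exact ha hg
  have e1 : ∀ x ∈ ({a * a, a} : Set X), ∀ C, {y | x * y ∈ C} ∈ (maj (a * a) a g).1 ↔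
      C ∈ (maj (a * a) a g).1 := by
    rintro x (rfl | rfl) C
    · simp only [mem_maj, TwoOf, mem_ofPred_eq, hag, haa, mul_assoc]
    · simp only [mem_maj, TwoOf, mem_ofPred_eq, hag, haa]
      tauto
  have e2 : ∀ x ∈ ({a * a, a} : Set X), ∀ C,
      {y | x * y ∈ C} ∈ (gen {a * a, a} (insert_nonempty _ _)).1 ↔
      C ∈ (gen {a * a, a} (insert_nonempty _ _)).1 := by
    rintro x (rfl | rfl) C <;>
      simp only [mem_gen, insert_subset_iff, singleton_subset_iff, mem_ofPred_eq, haa, mul_assoc]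
    exact and_comm
  have heq := eq_of_invariant hc (linked_maj _ _ _) (linked_gen _ _)
    (by simp [mem_maj, TwoOf]) Subset.rfl e1 e2
  have hmem : {a * a, g} ∈ (maj (a * a) a g).1 := by simp [mem_maj, TwoOf]
  rw [heq, mem_gen] at hmem
  rcases hmem (mem_insert_of_mem _ rfl) with h | h
  · exact ha h.symm
  · exact hne' h.symm

theorem eq_or_eq_of_not_idem (hc : idemCommOn (N2S X))
    (h : subCliffordOn (N2S X) ∨ regularIn (N2S X) (N2S X)) {a : X} (ha : a * a ≠ a) (c : X) :
    c = a * a ∨ c = a := by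
  have h3 := mul_mul_self hc h
  have hidem : ∀ f : X, f * f = f → f = a * a := by
    intro f hf
    by_cases hg : f * (a * a) = a * a
    · exact eq_of_mul_eq hc h ha hf hg
    exfalso
    have hcf := commute_of_idem hc hf
    have hgg : f * (a * a) * (f * (a * a)) = f * (a * a) := by
      rw [mul_assoc f, ← mul_assoc (a * a) f, ← hcf, mul_assoc f, mul_self_idem (h3 a),
        ← mul_assoc, hf]
    by_cases hga : f * (a * a) * a = f * (a * a)
    · exact hg (eq_of_zero hc ha (h3 a) hgg hga)
    · have hsq : f * a * (f * a) = f * (a * a) := by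
        rw [mul_assoc, ← mul_assoc a, ← hcf, mul_assoc f, ← mul_assoc, hf]
      have hfa : f * (a * a) * a = f * a := by rw [mul_assoc, h3]
      rw [hfa] at hga
      have := eq_of_mul_eq hc h (a := f * a) (f := a * a) (by rw [hsq]; exact Ne.symm hga)
        (mul_self_idem (h3 a)) (by rw [hsq, ← mul_assoc, ← hcf, mul_assoc, mul_self_idem (h3 a)])
      exact hg (by rw [← hsq, ← this])
  by_contra! hne
  have hsq : ∀ x : X, x * x = a * a := fun x => hidem _ (mul_self_idem (h3 x))
  have h1 : ∀ x : X, a * a * x = x := fun x => by rw [← hsq x, h3]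
  have h2 : ∀ x : X, x * (a * a) = x := fun x => by rw [← hsq x, ← mul_assoc, h3]
  have hcomm : c * a = a * c := by
    have hL : ∀ x, (a * c) * ((a * c) * x) = x := fun x => by rw [← mul_assoc, hsq, h1]
    have : (a * c) * (c * a) = (a * c) * (a * c) := by
      rw [hsq (a * c), mul_assoc, ← mul_assoc c, hsq c, h1]
    rw [← hL (c * a), this, hL]
  generalize he : a * a = e at *
  have hca : ∀ x, c * (a * x) = a * (c * x) := fun x => by rw [← mul_assoc, hcomm, mul_assoc]
  have haa : ∀ x, a * (a * x) = x := fun x => by rw [← mul_assoc, he, h1]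
  have hcc : ∀ x, c * (c * x) = x := fun x => by rw [← mul_assoc, hsq, h1]
  have k1 : a * c ≠ e := fun h => hne.2 (by rw [← haa c, h, h2])
  have k2 : a * c ≠ a := fun h => hne.1 (by rw [← haa c, h, he])
  have k3 : a * c ≠ c := fun h => ha (by rw [← h2 a, ← hsq c, ← mul_assoc, h])
  obtain ⟨x, hx⟩ := exists_mul_mul_mem h (K := {e, a, c}) (M := {e, a, c, a * c})
    (by ext z; simp [ h1, h2, hsq, hcomm]; grind)
    (by ext z; simp [ h1, h2, hsq, hcomm, mul_assoc, haa]; grind)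
    (u := e) (w := a) (by simp) (by simp)
  have hxe := (hx e (by simp)).1
  have hxa := (hx a (by simp)).1
  have hxc := (hx c (by simp)).2
  rw [h1] at hxa
  rw [h1, h2] at hxe
  simp only [mem_insert_iff, mem_singleton_iff] at hxe hxa hxc
  rcases hxe with rfl | rfl | rfl
  · rw [h2] at hxc; tauto
  · have := (hx c (by simp)).1
    rw [h1] at this
    simp only [mem_insert_iff, mem_singleton_iff] at this
    tauto
  · rw [hcomm] at hxa; tauto

end Necessity

section Linear

variable {X : Type*} [Semigroup X]

open Upfamily

theorem mul_eq_or_of_idem (hc : idemCommOn (N2S X))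
    (h : subCliffordOn (N2S X) ∨ regularIn (N2S X) (N2S X)) (hi : ∀ x : X, x * x = x)
    (x y : X) : x * y = x ∨ x * y = y := by
  have hcomm : ∀ p q : X, p * q = q * p := fun p q => commute_of_idem hc (hi p) q
  have hxy : x * (x * y) = x * y := by rw [← mul_assoc, hi]
  have hyx : y * (x * y) = x * y := by rw [hcomm, mul_assoc, hi]
  obtain ⟨u, hu⟩ := exists_mul_mul_mem h (K := {x, y}) (M := {x, y, x * y})
    (by ext z; simp [hi, hcomm y x]; grind)
    (by ext z; simp [hi, hcomm y x, hcomm (x * y), hxy, hyx]; grind)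
    (u := x) (w := x) (by simp) (by simp)
  rcases (hu y (by simp)).1 with h | h
  · left
    nth_rw 1 [← h]
    rw [mul_assoc, hi, h]
  · right
    rw [mem_singleton_iff] at h
    nth_rw 1 [← h]
    rw [mul_assoc x u y, ← mul_assoc x x, hi, ← mul_assoc, h]

/-- The natural order of a commutative linear semigroup. -/
noncomputable abbrev linearOrderOfMul (hc : ∀ x y : X, x * y = y * x)
    (hl : ∀ x y : X, x * y = x ∨ x * y = y) : LinearOrder X where
  le x y := x * y = x
  le_refl x := (hl x x).elim id id
  le_trans x y z hxy hyz := by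
    rw [← hxy, mul_assoc, hyz]
  le_antisymm x y hxy hyx := by rw [← hxy, hc, hyx]
  le_total x y := (hl x y).imp id fun h => by rw [hc, h]
  toDecidableLE := Classical.decRel _

theorem finite_of_linear (hi : idemCommOn (N2S X)) (hc : ∀ x y : X, x * y = y * x)
    (hl : ∀ x y : X, x * y = x ∨ x * y = y) : Finite X := by
  by_contra hfin
  rw [not_finite_iff_infinite] at hfin
  let _ := linearOrderOfMul hc hl
  obtain ⟨g, hg⟩ := exists_increasing_or_nonincreasing_subseq (α := X) (· ≤ ·)
    (Infinite.natEmbedding X)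
  obtain ⟨s, hs, hmul⟩ : ∃ s : ℕ → X, Function.Injective s ∧
      ((∀ m n, m < n → s m * s n = s m) ∨ ∀ m n, m < n → s m * s n = s n) :=
    ⟨fun n => Infinite.natEmbedding X (g n),
      (Infinite.natEmbedding X).injective.comp g.injective,
      hg.imp id fun h m n hmn => (hl _ _).resolve_left (h m n hmn)⟩
  have hst := hi (tail fun n => s (2 * n)) (linked_tail _) (tail fun n => s (2 * n + 1))
    (linked_tail _) (mul_self_of_linear hl _) (mul_self_of_linear hl _)
  have hlink := (linked_tail fun n => s (2 * n)).mul (linked_tail fun n => s (2 * n + 1))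
  have hmem : ∀ (p q : ℕ → X) (C : Set X), (∀ m, ∃ N, ∀ n ≥ N, p m * q n ∈ C) →
      C ∈ (tail p * tail q).1 := fun p q C h => by
    rw [Upfamily.mem_mul]
    exact Filter.Eventually.of_forall fun m => Filter.eventually_atTop.2 (h m)
  have key : ∀ p q : ℕ → X, (∀ m n, p m ≠ q n) →
      range p ∈ (tail (fun n => s (2 * n)) * tail fun n => s (2 * n + 1)).1 →
      range q ∈ (tail (fun n => s (2 * n)) * tail fun n => s (2 * n + 1)).1 → False := by
    intro p q hpq hp hq
    obtain ⟨_, ⟨m, rfl⟩, n, hn⟩ := hlink _ hp _ hq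
    exact hpq m n hn.symm
  have hne : ∀ m n, s (2 * m) ≠ s (2 * n + 1) := fun m n h => by have := hs h; omega
  rcases hmul with h | h
  · refine key _ _ hne ?_ ?_
    · exact hmem _ _ _ fun m => ⟨m, fun n hn => ⟨m, (h _ _ (by omega)).symm⟩⟩
    · rw [hst]
      exact hmem _ _ _ fun m => ⟨m + 1, fun n hn => ⟨m, (h _ _ (by omega)).symm⟩⟩
  · refine key _ _ hne ?_ ?_
    · rw [hst]
      exact hmem _ _ _ fun m => ⟨m + 1, fun n hn => ⟨n, (h _ _ (by omega)).symm⟩⟩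
    · exact hmem _ _ _ fun m => ⟨m, fun n hn => ⟨n, (h _ _ (by omega)).symm⟩⟩

theorem exists_mulEquiv_L [Finite X] (hc : ∀ x y : X, x * y = y * x)
    (hl : ∀ x y : X, x * y = x ∨ x * y = y) : ∃ n, Nonempty (X ≃* L n) := by
  let _ := linearOrderOfMul hc hl
  have := Fintype.ofFinite X
  let f := (Fintype.orderIsoFinOfCardEq X rfl).symm
  refine ⟨Fintype.card X, ⟨⟨f.toEquiv, fun x y => ?_⟩⟩⟩
  change f (x * y) = min (f x) (f y)
  rw [← f.map_inf]
  congr 1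
  rcases le_total x y with h | h
  · rw [inf_of_le_left h]; exact h
  · rw [inf_of_le_right h, hc]; exact h

/-- Upfamilies on a finite commutative linear semigroup commute. -/
theorem upfamily_mul_comm_of_linear [Finite X] (hc : ∀ x y : X, x * y = y * x)
    (hl : ∀ x y : X, x * y = x ∨ x * y = y) (F G : Upfamily X) : F * G = G * F := by
  let _ := linearOrderOfMul hc hl
  suffices key : ∀ (F G : Upfamily X) (C : Set X), C ∈ (F * G).1 → C ∈ (G * F).1 from
    Upfamily.ext_mem fun C => ⟨key F G C, key G F C⟩
  intro F G C h
  rw [Upfamily.mem_mul] at h ⊢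
  set D := {x | {y | x * y ∈ C} ∈ G.1} with hD
  by_cases hDC : D ⊆ C
  · obtain ⟨x, hx, hmax⟩ := exists_max_image _ id (toFinite D) (F.2.2.1 _ h)
    refine G.mono hx fun y (hy : x * y ∈ C) => F.mono h fun z hz => ?_
    have hzx : z ≤ x := hmax z hz
    rcases le_total x y with hxy | hxy
    · have : z * y = z := hzx.trans hxy
      rw [mem_ofPred_eq, hc, this]
      exact hDC hz
    · rw [hc, show y * x = y from hxy] at hy
      rcases hl y z with h | h
      · rwa [mem_ofPred_eq, h]
      · rw [mem_ofPred_eq, h]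
        exact hDC hz
  · obtain ⟨x, ⟨hxD, hxC⟩, hmin⟩ := exists_min_image _ id (toFinite (D \ C)) (not_subset.1 hDC)
    refine G.mono hxD fun y (hy : x * y ∈ C) => F.mono h fun z hz => ?_
    have hxy : x * y = y := (hl x y).resolve_left fun h => hxC (h ▸ hy)
    have hyx : y ≤ x := (hc y x).trans hxy
    rw [hxy] at hy
    by_cases hzC : z ∈ C
    · rcases hl y z with h | h
      · rwa [mem_ofPred_eq, h]
      · rwa [mem_ofPred_eq, h]
    · have : y * z = y := hyx.trans (hmin z ⟨hz, hzC⟩)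
      rwa [mem_ofPred_eq, this]

end Linear

section TwoElements

variable {X : Type*} [Semigroup X]

open Upfamily

theorem nonempty_mulEquiv_cgrp_two {a : X} (ha : a * a ≠ a) (ha3 : a * a * a = a)
    (hX : ∀ c : X, c = a * a ∨ c = a) : Nonempty (X ≃* Cgrp 2) := by
  classical
  have haa : a * (a * a) = a := by rw [← mul_assoc, ha3]
  let f : X → Cgrp 2 := fun x => if x = a then .ofAdd 1 else .ofAdd 0
  have hf1 : f a = .ofAdd 1 := if_pos rfl
  have hf0 : f (a * a) = .ofAdd 0 := if_neg ha
  refine ⟨⟨Equiv.ofBijective f ⟨?_, ?_⟩, ?_⟩⟩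
  · intro x y hxy
    have h01 : (.ofAdd 0 : Cgrp 2) ≠ .ofAdd 1 := by decide
    rcases hX x with hx | hx <;> rcases hX y with hy | hy <;> rw [hx, hy] at hxy ⊢
    · exact absurd (hf0.symm.trans (hxy.trans hf1)) h01
    · exact absurd (hf0.symm.trans (hxy.symm.trans hf1)) h01
  · intro z
    induction z using Multiplicative.rec with | ofAdd z => ?_
    fin_cases z
    · exact ⟨a * a, hf0⟩
    · exact ⟨a, hf1⟩
  · intro x y
    change f (x * y) = f x * f y
    rcases hX x with rfl | rfl <;> rcases hX y with rfl | rfl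
    · rw [← mul_assoc, ha3, hf0]; rfl
    · rw [ha3, hf0, hf1]; rfl
    · rw [haa, hf0, hf1]; rfl
    · rw [hf0, hf1]; rfl

/-- Over a group of order two, linked upfamilies commute and satisfy `F³ = F`. -/
theorem linked_of_two {e a : X} (hX : ∀ c : X, c = e ∨ c = a) (hea : e * a = a) (hae : a * e = a)
    (hee : e * e = e) (haa : a * a = e) {F G : Upfamily X} (hF : F.Linked) (hG : G.Linked) :
    F * G = G * F ∧ F * F * F = F := by
  have hne : (univ : Set X).Nonempty := nonempty_of_mem (mem_univ e)
  have hcomm : ∀ x y : X, x * y = y * x := by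
    intro x y
    rcases hX x with rfl | rfl <;> rcases hX y with rfl | rfl <;> simp_all
  have hsq : ∀ x y : X, x * (x * y) = y := by
    intro x y
    rcases hX x with rfl | rfl <;> rcases hX y with rfl | rfl <;> simp_all
  have hinv : ∀ x ∈ (univ : Set X), ∀ C : Set X,
      {y | x * y ∈ C} ∈ (gen univ hne).1 ↔ C ∈ (gen univ hne).1 := by
    intro x _ C
    simp only [mem_gen, univ_subset_iff, eq_univ_iff_forall, mem_ofPred_eq]
    constructor
    · intro h y
      rw [← hsq x y]
      exact h _
    · exact fun h y => h _
  have hunivmem : ∀ F : Upfamily X, univ ∈ F.1 := fun F =>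
    let ⟨_, hA⟩ := F.2.1
    F.mono hA (subset_univ _)
  have hT : ∀ {F : Upfamily X}, F.Linked →
      F * gen univ hne = gen univ hne := fun hF =>
    mul_eq_right hF (hunivmem _) hinv
  have hT' : ∀ x, gen univ hne * gen {x} (singleton_nonempty x) =
      gen univ hne := fun x => by
    have huniv : image2 (· * ·) univ {x} = univ := eq_univ_of_forall fun y =>
      ⟨x * y, mem_univ _, x, rfl, (hcomm _ _).trans (hsq x y)⟩
    rw [gen_mul_gen]
    exact gen_congr huniv
  rcases linked_cases_of_two hX hF with ⟨x, rfl⟩ | rfl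
  · refine ⟨?_, ?_⟩
    · rcases linked_cases_of_two hX hG with ⟨y, rfl⟩ | rfl
      · rw [gen_singleton_mul, gen_singleton_mul]
        exact gen_congr (by rw [hcomm])
      · rw [hT hF, hT']
    · rw [gen_singleton_mul, gen_singleton_mul]
      exact gen_congr (by rw [mul_assoc, hsq])
  · refine ⟨?_, by rw [hT hF, hT hF]⟩
    rcases linked_cases_of_two hX hG with ⟨y, rfl⟩ | rfl
    · rw [hT hG, hT']
    · rfl

end TwoElements

section Abstract

variable {M : Type*} [Mul M] {S : Set M}

theorem cliffordOn_of_cube (hassoc : ∀ a b c : M, a * b * c = a * (b * c)) (hS : mulClosed S)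
    (h3 : ∀ a ∈ S, a * a * a = a) : cliffordOn S := by
  intro a ha
  have h := h3 a ha
  have h' : a * (a * a) = a := by rw [← hassoc, h]
  have h4 : a * a * (a * a) = a * a := by rw [← hassoc, h]
  refine ⟨{a, a * a}, ?_, ⟨?_, a * a, by simp, ?_, ?_⟩, by simp⟩
  · rintro _ (rfl | rfl)
    · exact ha
    · exact hS a ha a ha
  · rintro _ (rfl | rfl) _ (rfl | rfl) <;> simp [h, h', h4]
  · rintro _ (rfl | rfl) <;> simp [h, h', h4]
  · rintro _ (rfl | rfl)
    · exact ⟨_, mem_insert _ _, rfl, rfl⟩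
    · exact ⟨_, mem_insert_of_mem _ rfl, h4, h4⟩

theorem inverseOn_of_comm_clifford (hassoc : ∀ a b c : M, a * b * c = a * (b * c))
    (hc : commOn S) (hcl : cliffordOn S) : inverseOn S := by
  intro a ha
  obtain ⟨H, hHS, ⟨-, e, he, hid, hinv⟩, haH⟩ := hcl a ha
  obtain ⟨b, hb, hab, hba⟩ := hinv a haH
  refine ⟨b, ⟨hHS hb, by rw [hab, (hid a haH).1], by rw [hba, (hid b hb).1]⟩, ?_⟩
  rintro c ⟨hcS, h1, h2⟩
  have hca := hc c hcS a ha
  have hace : a * c = e := by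
    calc a * c = e * a * c := by rw [(hid a haH).1]
      _ = b * (a * c * a) := by rw [← hba, hassoc, hassoc, hassoc, hca]
      _ = e := by rw [h1, hba]
  have hec : c = e * c := by rw [← hace, ← hca, h2]
  calc c = e * c := hec
    _ = b * (a * c) := by rw [← hba, hassoc]
    _ = b := by rw [hace, (hid b hb).2]

theorem regularIn_of_inverseOn (h : inverseOn S) : regularIn S S := fun a ha =>
  let ⟨b, hb, _⟩ := h a ha
  ⟨b, hb.1, hb.2.1⟩

theorem idemCommOn_of_inverseOn (hassoc : ∀ a b c : M, a * b * c = a * (b * c))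
    (hS : mulClosed S) (h : inverseOn S) : idemCommOn S := by
  have hidem : ∀ e ∈ S, ∀ f ∈ S, e * e = e → f * f = f → e * f * (e * f) = e * f := by
    intro e he f hf hee hff
    have hee' : ∀ z, e * (e * z) = e * z := fun z => by rw [← hassoc, hee]
    have hff' : ∀ z, f * (f * z) = f * z := fun z => by rw [← hassoc, hff]
    obtain ⟨x, ⟨hx, h1, h2⟩, huniq⟩ := h (e * f) (hS _ he _ hf)
    have h2' : ∀ z, x * (e * (f * (x * z))) = x * z := fun z => by
      conv_rhs => rw [← h2]
      simp only [hassoc]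
    have hxx : f * x * e = x := huniq _ ⟨hS _ (hS _ hf _ hx) _ he, by
      simpa only [hassoc, hee', hff'] using h1, by
      simp only [hassoc, hee', hff', h2']⟩
    have hxi : x * x = x := by
      calc x * x = (f * x * e) * (f * x * e) := by rw [hxx]
        _ = f * x * e := by simp only [hassoc, h2']
        _ = x := hxx
    obtain ⟨y, -, huniq'⟩ := h x hx
    have e1 := huniq' x ⟨hx, by rw [hxi, hxi], by rw [hxi, hxi]⟩
    have e2 := huniq' (e * f) ⟨hS _ he _ hf, h2, h1⟩
    rw [e2, ← e1, hxi]
  intro e he f hf hee hff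
  have hef := hidem e he f hf hee hff
  have hfe := hidem f hf e he hff hee
  have hee' : ∀ z, e * (e * z) = e * z := fun z => by rw [← hassoc, hee]
  have hff' : ∀ z, f * (f * z) = f * z := fun z => by rw [← hassoc, hff]
  obtain ⟨y, -, huniq⟩ := h (e * f) (hS _ he _ hf)
  rw [huniq (e * f) ⟨hS _ he _ hf, by rw [hef, hef], by rw [hef, hef]⟩]
  refine (huniq (f * e) ⟨hS _ hf _ he, ?_, ?_⟩).symm
  · simpa only [hassoc, hee', hff'] using hef
  · simpa only [hassoc, hee', hff'] using hfe

end Abstract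

/-- Theorem 1.3: for a semigroup `X`, the following are equivalent:
(1) `N₂(X)` is a commutative Clifford semigroup;
(2) `N₂(X)` is an inverse semigroup;
(3) the idempotents of `N₂(X)` commute and `N₂(X)` is sub-Clifford or regular;
(4) `X` is isomorphic to `C₂` or to `Lₙ` for some `n ∈ ω`. -/
theorem linkedUpfamilies_inverse_characterization (X : Type*) [Semigroup X] :
    List.TFAE
      [commOn (N2S X) ∧ cliffordOn (N2S X),
        inverseOn (N2S X),
        idemCommOn (N2S X) ∧ (subCliffordOn (N2S X) ∨ regularIn (N2S X) (N2S X)),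
        Nonempty (X ≃* Cgrp 2) ∨ ∃ n : ℕ, Nonempty (X ≃* L n)] := by
  have hmul : mulClosed (N2S X) := fun _ ha _ hb => Upfamily.Linked.mul ha hb
  tfae_have 1 → 2 := fun h =>
    inverseOn_of_comm_clifford Upfamily.mul_assoc h.1 h.2
  tfae_have 2 → 3 := fun h =>
    ⟨idemCommOn_of_inverseOn Upfamily.mul_assoc hmul h, Or.inr (regularIn_of_inverseOn h)⟩
  tfae_have 3 → 4 := by
    rintro ⟨hc, h⟩
    by_cases hi : ∀ x : X, x * x = x
    · have hcomm : ∀ x y : X, x * y = y * x := fun x y => commute_of_idem hc (hi x) y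
      have hl := mul_eq_or_of_idem hc h hi
      have := finite_of_linear hc hcomm hl
      exact Or.inr (exists_mulEquiv_L hcomm hl)
    · push Not at hi
      obtain ⟨a, ha⟩ := hi
      exact Or.inl (nonempty_mulEquiv_cgrp_two ha (mul_mul_self hc h a)
        (eq_or_eq_of_not_idem hc h ha))
  tfae_have 4 → 1 := by
    rintro (⟨⟨φ⟩⟩ | ⟨n, ⟨φ⟩⟩)
    · have hX : ∀ c : X, c = φ.symm (.ofAdd 0) ∨ c = φ.symm (.ofAdd 1) := by
        intro c
        simp only [MulEquiv.eq_symm_apply]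
        generalize φ c = z
        revert z
        decide
      have key : ∀ {F G : Upfamily X}, F.Linked → G.Linked →
          F * G = G * F ∧ F * F * F = F := by
        refine linked_of_two hX ?_ ?_ ?_ ?_ <;> rw [← map_mul] <;> rfl
      exact ⟨fun _ ha _ hb => (key ha hb).1,
        cliffordOn_of_cube Upfamily.mul_assoc hmul fun _ ha => (key ha ha).2⟩
    · have hc : ∀ x y : X, x * y = y * x := fun x y => φ.injective <| by
        rw [map_mul, map_mul]
        exact min_comm (α := Fin n) _ _
      have hl : ∀ x y : X, x * y = x ∨ x * y = y := fun x y => by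
        simp only [← φ.injective.eq_iff, map_mul]
        exact min_choice (α := Fin n) _ _
      have : Finite X := Finite.of_injective (β := Fin n) φ φ.injective
      refine ⟨fun F _ G _ => upfamily_mul_comm_of_linear hc hl F G,
        cliffordOn_of_cube Upfamily.mul_assoc hmul fun F _ => ?_⟩
      rw [Upfamily.mul_self_of_linear hl, Upfamily.mul_self_of_linear hl]
  tfae_finish
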